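/- Let A be a weak Hopf algebra over a field K. The antipode S is antimultiplicative (S(xy) = S(y)S(x) for all x, y) and anticomultiplicative (Δ(S(x)) = Σ S(x₍₂₎) ⊗ S(x₍₁₎) for all x), satisfies S(1) = 1 and ε ∘ S = ε, maps A^L bijectively onto A^R and A^R bijectively onto A^L, and S : A → A is bijective. -/

import Mathlib

open TensorProduct

noncomputable section

variable (K : Type*) [Field K] (A : Type*) [Ring A] [Algebra K A]

/-- `Π^L(x) = Σ ε(1₍₁₎ x) 1₍₂₎`. -/
def piL (Δ : A →ₗ[K] A ⊗[K] A) (ε : A →ₗ[K] K) : A →ₗ[K] A :=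
  (TensorProduct.lid K A).toLinearMap ∘ₗ ε.rTensor A ∘ₗ
    LinearMap.mulLeft K (Δ 1) ∘ₗ (TensorProduct.mk K A A).flip 1

/-- `Π^R(x) = Σ 1₍₁₎ ε(x 1₍₂₎)`. -/
def piR (Δ : A →ₗ[K] A ⊗[K] A) (ε : A →ₗ[K] K) : A →ₗ[K] A :=
  (TensorProduct.rid K A).toLinearMap ∘ₗ ε.lTensor A ∘ₗ
    LinearMap.mulRight K (Δ 1) ∘ₗ TensorProduct.mk K A A 1

/-- A weak bialgebra structure on the `K`-algebra `A`, with comultiplication `Δ`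
and counit `ε`. -/
structure WeakBialgebra (Δ : A →ₗ[K] A ⊗[K] A) (ε : A →ₗ[K] K) : Prop where
  coassoc : ∀ x : A,
    (TensorProduct.assoc K A A A) (Δ.rTensor A (Δ x)) = Δ.lTensor A (Δ x)
  counit_left : ∀ x : A, (TensorProduct.lid K A) (ε.rTensor A (Δ x)) = x
  counit_right : ∀ x : A, (TensorProduct.rid K A) (ε.lTensor A (Δ x)) = x
  comul_mul : ∀ x y : A, Δ (x * y) = Δ x * Δ y
  weak_counit_a : ∀ x y z : A,
    ε (x * y * z) =
      LinearMap.mul' K K (TensorProduct.map (ε ∘ₗ LinearMap.mulLeft K x)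
        (ε ∘ₗ LinearMap.mulRight K z) (Δ y))
  weak_counit_b : ∀ x y z : A,
    ε (x * y * z) =
      LinearMap.mul' K K (TensorProduct.map (ε ∘ₗ LinearMap.mulRight K z)
        (ε ∘ₗ LinearMap.mulLeft K x) (Δ y))
  weak_comul_unit_a :
    Δ.rTensor A (Δ 1) =
      (Δ 1 ⊗ₜ[K] (1 : A)) * ((TensorProduct.assoc K A A A).symm ((1 : A) ⊗ₜ[K] Δ 1))
  weak_comul_unit_b :
    Δ.rTensor A (Δ 1) =
      ((TensorProduct.assoc K A A A).symm ((1 : A) ⊗ₜ[K] Δ 1)) * (Δ 1 ⊗ₜ[K] (1 : A))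

/-- A weak Hopf algebra structure: a weak bialgebra together with an antipode `S`. -/
structure WeakHopfAlgebra (Δ : A →ₗ[K] A ⊗[K] A) (ε : A →ₗ[K] K) (S : A →ₗ[K] A) : Prop where
  toWeakBialgebra : WeakBialgebra K A Δ ε
  antipode_a : ∀ x : A,
    LinearMap.mul' K A (LinearMap.lTensor A S (Δ x)) = piL K A Δ ε x
  antipode_b : ∀ x : A,
    LinearMap.mul' K A (LinearMap.rTensor A S (Δ x)) = piR K A Δ ε x
  antipode_c : ∀ x : A,
    LinearMap.mul' K A (TensorProduct.map S (LinearMap.mul' K A ∘ₗ LinearMap.lTensor A S)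
      (LinearMap.lTensor A Δ (Δ x))) = S x

section Sweedler

variable {K A}
variable {M N : Type*} [AddCommGroup M] [Module K M] [AddCommGroup N] [Module K N]

/-- Unbundled bilinearity. -/
structure IsBilin (K : Type*) [Field K] {A : Type*} [Ring A] [Algebra K A]
    {M : Type*} [AddCommGroup M] [Module K M] (B : A → A → M) : Prop where
  add_left : ∀ a a' b, B (a + a') b = B a b + B a' b
  smul_left : ∀ (r : K) a b, B (r • a) b = r • B a b
  add_right : ∀ a b b', B a (b + b') = B a b + B a b'
  smul_right : ∀ (r : K) a b, B a (r • b) = r • B a b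

/-- Unbundled trilinearity. -/
structure IsTrilin (K : Type*) [Field K] {A : Type*} [Ring A] [Algebra K A]
    {M : Type*} [AddCommGroup M] [Module K M] (T : A → A → A → M) : Prop where
  add_left : ∀ a a' b c, T (a + a') b c = T a b c + T a' b c
  smul_left : ∀ (r : K) a b c, T (r • a) b c = r • T a b c
  add_mid : ∀ a b b' c, T a (b + b') c = T a b c + T a b' c
  smul_mid : ∀ (r : K) a b c, T a (r • b) c = r • T a b c
  add_right : ∀ a b c c', T a b (c + c') = T a b c + T a b c'
  smul_right : ∀ (r : K) a b c, T a b (r • c) = r • T a b c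

theorem IsTrilin.isBilin {T : A → A → A → M} (hT : IsTrilin K T) (c : A) :
    IsBilin K fun a b => T a b c where
  add_left _ _ _ := hT.add_left ..
  smul_left _ _ _ := hT.smul_left ..
  add_right _ _ _ := hT.add_mid ..
  smul_right _ _ _ := hT.smul_mid ..

/-- The linear map on `A ⊗ A` induced by a bilinear function. -/
def IsBilin.lift {B : A → A → M} (hB : IsBilin K B) : A ⊗[K] A →ₗ[K] M :=
  TensorProduct.lift (LinearMap.mk₂ K B hB.add_left hB.smul_left hB.add_right hB.smul_right)

@[simp] theorem IsBilin.lift_tmul {B : A → A → M} (hB : IsBilin K B) (a b : A) :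
    hB.lift (a ⊗ₜ b) = B a b := rfl

/-- The linear map on `(A ⊗ A) ⊗ A` induced by a trilinear function. -/
def IsTrilin.lift {T : A → A → A → M} (hT : IsTrilin K T) : (A ⊗[K] A) ⊗[K] A →ₗ[K] M :=
  TensorProduct.lift (LinearMap.flip
    { toFun := fun c => (hT.isBilin c).lift
      map_add' := fun c c' => TensorProduct.ext' fun a b => hT.add_right a b c c'
      map_smul' := fun r c => TensorProduct.ext' fun a b => hT.smul_right r a b c })

@[simp] theorem IsTrilin.lift_tmul {T : A → A → A → M} (hT : IsTrilin K T) (a b c : A) :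
    hT.lift ((a ⊗ₜ b) ⊗ₜ c) = T a b c := rfl

variable [FiniteDimensional K A]

/-- The first tensor legs of `Δ` when the second legs are the vectors of a fixed basis. -/
def comulCoord (Δ : A →ₗ[K] A ⊗[K] A) (i : Fin (Module.finrank K A)) : A →ₗ[K] A :=
  (TensorProduct.rid K A).toLinearMap ∘ₗ ((Module.finBasis K A).coord i).lTensor A ∘ₗ Δ

/-- The Sweedler sum `Σ B(x₍₁₎, x₍₂₎)`. -/
def sweedler (Δ : A →ₗ[K] A ⊗[K] A) (x : A) (B : A → A → M) : M :=
  ∑ i, B (comulCoord Δ i x) (Module.finBasis K A i)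

theorem sum_comulCoord_tmul (Δ : A →ₗ[K] A ⊗[K] A) (x : A) :
    ∑ i, comulCoord Δ i x ⊗ₜ[K] Module.finBasis K A i = Δ x := by
  simp only [comulCoord, LinearMap.comp_apply]
  generalize Δ x = t
  induction t using TensorProduct.induction_on with
  | zero => simp
  | tmul a b =>
    simp only [LinearMap.lTensor_tmul, Module.Basis.coord_apply, LinearEquiv.coe_coe,
      TensorProduct.rid_tmul, TensorProduct.smul_tmul]
    rw [← TensorProduct.tmul_sum, Module.Basis.sum_repr]
  | add s t hs ht =>
    simp only [map_add, TensorProduct.add_tmul, Finset.sum_add_distrib, hs, ht]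

variable {Δ : A →ₗ[K] A ⊗[K] A}

theorem sweedler_tmul (x : A) : sweedler Δ x (fun a b => a ⊗ₜ[K] b) = Δ x :=
  sum_comulCoord_tmul Δ x

theorem map_sweedler (f : M →ₗ[K] N) (x : A) (B : A → A → M) :
    f (sweedler Δ x B) = sweedler Δ x fun a b => f (B a b) := by
  simp [sweedler]

theorem map_comul (f : A ⊗[K] A →ₗ[K] M) (x : A) :
    f (Δ x) = sweedler Δ x fun a b => f (a ⊗ₜ b) := by
  rw [← sweedler_tmul, map_sweedler]

theorem IsBilin.lift_comul {B : A → A → M} (hB : IsBilin K B) (x : A) :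
    hB.lift (Δ x) = sweedler Δ x B := by
  simp [map_comul]

omit [Module K M] in
theorem sweedler_congr {x : A} {B B' : A → A → M} (hB : ∀ a b, B a b = B' a b) :
    sweedler Δ x B = sweedler Δ x B' :=
  congrArg _ (funext₂ hB)

theorem IsBilin.sweedler_left {B : A → A → M} (hB : IsBilin K B) (x b : A) (F : A → A → A) :
    B (sweedler Δ x F) b = sweedler Δ x fun p q => B (F p q) b :=
  map_sweedler (M := A) ⟨⟨(B · b), (hB.add_left · · b)⟩, (hB.smul_left · · b)⟩ x F

theorem IsBilin.sweedler_right {B : A → A → M} (hB : IsBilin K B) (x a : A) (F : A → A → A) :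
    B a (sweedler Δ x F) = sweedler Δ x fun p q => B a (F p q) :=
  map_sweedler (M := A) ⟨⟨B a, hB.add_right a⟩, (hB.smul_right · a)⟩ x F

theorem smul_sweedler (r : K) (x : A) (B : A → A → M) :
    r • sweedler Δ x B = sweedler Δ x fun a b => r • B a b := Finset.smul_sum

theorem mul_sweedler {R : Type*} [Ring R] (x : A) (y : R) (B : A → A → R) :
    y * sweedler Δ x B = sweedler Δ x fun a b => y * B a b := Finset.mul_sum ..

theorem sweedler_mul {R : Type*} [Ring R] (x : A) (y : R) (B : A → A → R) :
    sweedler Δ x B * y = sweedler Δ x fun a b => B a b * y := Finset.sum_mul ..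

omit [Module K M] in
theorem sweedler_comm (x y : A) (F : A → A → A → A → M) :
    sweedler Δ x (fun a b => sweedler Δ y fun c d => F a b c d) =
      sweedler Δ y fun c d => sweedler Δ x fun a b => F a b c d := Finset.sum_comm

variable {ε : A →ₗ[K] K}

namespace WeakBialgebra

variable (h : WeakBialgebra K A Δ ε)
include h

theorem sweedler_coassoc (x : A) {T : A → A → A → M} (hT : IsTrilin K T) :
    sweedler Δ x (fun a b => sweedler Δ a fun c d => T c d b) =
      sweedler Δ x fun a b => sweedler Δ b fun c d => T a c d := by
  have := congrArg (hT.lift ∘ₗ (TensorProduct.assoc K A A A).symm.toLinearMap) (h.coassoc x)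
  simpa [← sweedler_tmul, sweedler, TensorProduct.sum_tmul, TensorProduct.tmul_sum] using this

theorem sweedler_mul_arg (x y : A) {B : A → A → M} (hB : IsBilin K B) :
    sweedler Δ (x * y) B =
      sweedler Δ x fun a b => sweedler Δ y fun c d => B (a * c) (b * d) := by
  rw [← hB.lift_comul, h.comul_mul, ← sweedler_tmul x, ← sweedler_tmul y]
  simp [sweedler, Finset.sum_mul_sum]

theorem sweedler_counit_left (x : A) : sweedler Δ x (fun a b => ε a • b) = x := by
  have := h.counit_left x
  simpa [← sweedler_tmul, sweedler] using this

theorem sweedler_counit_right (x : A) : sweedler Δ x (fun a b => ε b • a) = x := by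
  have := h.counit_right x
  simpa [← sweedler_tmul, sweedler] using this

theorem counit_mul_mul (x y z : A) :
    ε (x * y * z) = sweedler Δ y fun a b => ε (x * a) * ε (b * z) := by
  rw [h.weak_counit_a, ← sweedler_tmul]
  simp [sweedler]

theorem counit_mul_mul' (x y z : A) :
    ε (x * y * z) = sweedler Δ y fun a b => ε (x * b) * ε (a * z) := by
  rw [h.weak_counit_b, ← sweedler_tmul]
  simp [sweedler, mul_comm]

theorem sweedler_one {T : A → A → A → M} (hT : IsTrilin K T) :
    sweedler Δ 1 (fun a b => sweedler Δ a fun c d => T c d b) =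
      sweedler Δ 1 fun a b => sweedler Δ 1 fun c d => T a (b * c) d := by
  have := congrArg hT.lift h.weak_comul_unit_a
  simpa [← sweedler_tmul, sweedler, TensorProduct.sum_tmul, TensorProduct.tmul_sum,
    Finset.sum_mul_sum] using this

theorem sweedler_one' {T : A → A → A → M} (hT : IsTrilin K T) :
    sweedler Δ 1 (fun a b => sweedler Δ a fun c d => T c d b) =
      sweedler Δ 1 fun a b => sweedler Δ 1 fun c d => T a (c * b) d := by
  have := congrArg hT.lift h.weak_comul_unit_b
  rw [sweedler_comm]
  simpa [← sweedler_tmul, sweedler, TensorProduct.sum_tmul, TensorProduct.tmul_sum,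
    Finset.sum_mul_sum] using this

end WeakBialgebra

theorem piL_eq (x : A) : piL K A Δ ε x = sweedler Δ 1 fun a b => ε (a * x) • b := by
  simp [piL, ← sweedler_tmul (Δ := Δ) 1, sweedler, Finset.sum_mul]

theorem piR_eq (x : A) : piR K A Δ ε x = sweedler Δ 1 fun a b => ε (x * b) • a := by
  simp [piR, ← sweedler_tmul (Δ := Δ) 1, sweedler, Finset.mul_sum]

namespace WeakHopfAlgebra

variable {S : A →ₗ[K] A} (h : WeakHopfAlgebra K A Δ ε S)
include h

theorem sweedler_mul_antipode (x : A) :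
    sweedler Δ x (fun a b => a * S b) = piL K A Δ ε x := by
  rw [← h.antipode_a]
  simp [← sweedler_tmul, sweedler]

theorem sweedler_antipode_mul (x : A) :
    sweedler Δ x (fun a b => S a * b) = piR K A Δ ε x := by
  rw [← h.antipode_b]
  simp [← sweedler_tmul, sweedler]

theorem sweedler_antipode_mul_piL (x : A) :
    sweedler Δ x (fun a b => S a * piL K A Δ ε b) = S x := by
  rw [← h.antipode_c]
  simp only [← h.sweedler_mul_antipode]
  simp [← sweedler_tmul, sweedler, TensorProduct.tmul_sum, Finset.mul_sum]

end WeakHopfAlgebra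

attribute [local simp] mul_add add_mul add_smul mul_smul TensorProduct.tmul_add
  TensorProduct.add_tmul Finset.smul_sum Finset.sum_add_distrib TensorProduct.smul_tmul'

namespace WeakBialgebra

variable (h : WeakBialgebra K A Δ ε)
include h

theorem sweedler_piL_right (x : A) {B : A → A → M} (hB : IsBilin K B) :
    sweedler Δ x (fun a b => B a (piL K A Δ ε b)) = sweedler Δ 1 fun a b => B (a * x) b := by
  have e (a b : A) : B (a * x) b =
      sweedler Δ a fun p q => sweedler Δ x fun r s => ε (q * s) • B (p * r) b := by
    conv_lhs => rw [← h.sweedler_counit_right (a * x)]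
    rw [h.sweedler_mul_arg]
    · simp only [hB.sweedler_left, hB.smul_left]
    · constructor <;> intros <;> simp [smul_comm (M := K) (N := K)]
  have e' (p r q s : A) : B (p * r) (piL K A Δ ε (q * s)) =
      sweedler Δ 1 fun c d => ε (c * q * s) • B (p * r) d := by
    rw [piL_eq]
    simp only [hB.sweedler_right, mul_assoc, hB.smul_right]
  simp only [e]
  rw [h.sweedler_one' (T := fun p q b => sweedler Δ x fun r s => ε (q * s) • B (p * r) b)]
  · conv_lhs => rw [← one_mul x]
    rw [h.sweedler_mul_arg]
    · refine sweedler_congr fun a b => ?_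
      simp only [e']
      rw [sweedler_comm]
    · constructor <;> intros <;>
        simp [hB.add_left, hB.add_right, hB.smul_left, hB.smul_right]
  · constructor <;> intros <;>
      simp [sweedler, hB.add_left, hB.add_right, hB.smul_left, hB.smul_right,
        smul_comm (M := K) (N := K)]

theorem sweedler_piR_left (x : A) {B : A → A → M} (hB : IsBilin K B) :
    sweedler Δ x (fun a b => B (piR K A Δ ε a) b) = sweedler Δ 1 fun a b => B a (x * b) := by
  have e (a b : A) : B a (x * b) =
      sweedler Δ b fun p q => sweedler Δ x fun r s => ε (r * p) • B a (s * q) := by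
    conv_lhs => rw [← h.sweedler_counit_left (x * b)]
    rw [h.sweedler_mul_arg, sweedler_comm]
    · simp only [hB.sweedler_right, hB.smul_right]
    · constructor <;> intros <;> simp [smul_comm (M := K) (N := K)]
  have e' (c r d s : A) : B (piR K A Δ ε (r * c)) (s * d) =
      sweedler Δ 1 fun a b => ε (r * (c * b)) • B a (s * d) := by
    rw [piR_eq]
    simp only [hB.sweedler_left, mul_assoc, hB.smul_left]
  have hT : IsTrilin K fun a p q => sweedler Δ x fun r s => ε (r * p) • B a (s * q) := by
    constructor <;> intros <;>
      simp [sweedler, hB.add_left, hB.add_right, hB.smul_left, hB.smul_right,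
        smul_comm (M := K) (N := K)]
  simp only [e]
  rw [← h.sweedler_coassoc 1 hT, h.sweedler_one' hT]
  conv_lhs => rw [← mul_one x]
  rw [h.sweedler_mul_arg, sweedler_comm, sweedler_comm 1 1]
  · refine sweedler_congr fun a b => ?_
    simp only [e']
    rw [sweedler_comm]
  · constructor <;> intros <;>
      simp [hB.add_left, hB.add_right, hB.smul_left, hB.smul_right]

theorem counit_mul_piL (x y : A) : ε (x * piL K A Δ ε y) = ε (x * y) := by
  rw [piL_eq, mul_sweedler, map_sweedler]
  conv_rhs => rw [← mul_one x, h.counit_mul_mul']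
  simp [mul_comm]

theorem counit_piR_mul (x y : A) : ε (piR K A Δ ε x * y) = ε (x * y) := by
  rw [piR_eq, sweedler_mul, map_sweedler]
  conv_rhs => rw [← mul_one x, h.counit_mul_mul']
  simp

theorem piL_mul_piL (x y : A) : piL K A Δ ε (x * piL K A Δ ε y) = piL K A Δ ε (x * y) := by
  simp only [piL_eq (x := x * _), ← mul_assoc, h.counit_mul_piL]

theorem piR_piR_mul (x y : A) : piR K A Δ ε (piR K A Δ ε x * y) = piR K A Δ ε (x * y) := by
  simp only [piR_eq (x := _ * y), mul_assoc, h.counit_piR_mul]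

theorem piL_one : piL K A Δ ε 1 = 1 := by
  simp [piL_eq, h.sweedler_counit_left]

theorem piR_one : piR K A Δ ε 1 = 1 := by
  simp [piR_eq, h.sweedler_counit_right]

theorem sweedler_piL_aux (x : A) {B : A → A → M} (hB : IsBilin K B) :
    sweedler Δ (piL K A Δ ε x) B =
      sweedler Δ 1 fun a b => sweedler Δ a fun c d => ε (c * x) • B d b := by
  rw [← hB.lift_comul, piL_eq, map_sweedler, map_sweedler, h.sweedler_coassoc
    (T := fun c d b => ε (c * x) • B d b)]
  · simp only [map_smul, hB.lift_comul]
    simp [sweedler]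
  · constructor <;> intros <;>
      simp [hB.add_left, hB.add_right, hB.smul_left, hB.smul_right, smul_comm (M := K) (N := K)]

omit h in
theorem sweedler_piR_aux (x : A) {B : A → A → M} (hB : IsBilin K B) :
    sweedler Δ (piR K A Δ ε x) B =
      sweedler Δ 1 fun a b => sweedler Δ a fun c d => ε (x * b) • B c d := by
  rw [← hB.lift_comul, piR_eq, map_sweedler, map_sweedler]
  simp only [map_smul, hB.lift_comul]
  simp [sweedler]

theorem sweedler_piL (x : A) {B : A → A → M} (hB : IsBilin K B) :
    sweedler Δ (piL K A Δ ε x) B = sweedler Δ 1 fun a b => B (a * piL K A Δ ε x) b := by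
  rw [h.sweedler_piL_aux x hB, h.sweedler_one' (T := fun c d b => ε (c * x) • B d b), sweedler_comm]
  · refine sweedler_congr fun c d => ?_
    simp only [piL_eq, mul_sweedler, hB.sweedler_left, mul_smul_comm, hB.smul_left]
  · constructor <;> intros <;>
      simp [hB.add_left, hB.add_right, hB.smul_left, hB.smul_right, smul_comm (M := K) (N := K)]

theorem sweedler_piR (x : A) {B : A → A → M} (hB : IsBilin K B) :
    sweedler Δ (piR K A Δ ε x) B = sweedler Δ 1 fun a b => B a (piR K A Δ ε x * b) := by
  rw [sweedler_piR_aux x hB, h.sweedler_one' (T := fun c d b => ε (x * b) • B c d)]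
  · refine sweedler_congr fun c d => ?_
    simp only [piR_eq, sweedler_mul, hB.sweedler_right, smul_mul_assoc, hB.smul_right]
  · constructor <;> intros <;>
      simp [hB.add_left, hB.add_right, hB.smul_left, hB.smul_right, smul_comm (M := K) (N := K)]

theorem piL_mul_piR_comm (x y : A) :
    piL K A Δ ε x * piR K A Δ ε y = piR K A Δ ε y * piL K A Δ ε x := by
  have hT : IsTrilin K fun a b c => ε (a * x) • ε (y * c) • b := by
    constructor <;> intros <;> simp [smul_comm (M := K) (N := K)]
  have := (h.sweedler_one hT).symm.trans (h.sweedler_one' hT)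
  simp only [piL_eq, piR_eq, sweedler_mul, mul_sweedler, smul_mul_assoc, mul_smul_comm,
    smul_sweedler]
  rw [sweedler_comm]
  simpa only [smul_comm (M := K) (N := K)] using this

theorem sweedler_piR_mul (x y : A) {B : A → A → M} (hB : IsBilin K B) :
    sweedler Δ (piR K A Δ ε x * y) B = sweedler Δ y fun a b => B a (piR K A Δ ε x * b) := by
  rw [h.sweedler_mul_arg _ _ hB,
    h.sweedler_piR x (B := fun a b => sweedler Δ y fun c d => B (a * c) (b * d))]
  · conv_rhs => rw [← one_mul y]
    rw [h.sweedler_mul_arg]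
    · simp only [mul_assoc]
    · constructor <;> intros <;>
        simp [hB.add_left, hB.add_right, hB.smul_left, hB.smul_right]
  · constructor <;> intros <;>
      simp [sweedler, hB.add_left, hB.add_right, hB.smul_left, hB.smul_right]

theorem sweedler_mul_piL (x y : A) {B : A → A → M} (hB : IsBilin K B) :
    sweedler Δ (x * piL K A Δ ε y) B = sweedler Δ x fun a b => B (a * piL K A Δ ε y) b := by
  rw [h.sweedler_mul_arg _ _ hB, sweedler_comm,
    h.sweedler_piL y (B := fun c d => sweedler Δ x fun a b => B (a * c) (b * d)), sweedler_comm]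
  · conv_rhs => rw [← mul_one x]
    rw [h.sweedler_mul_arg]
    · simp only [mul_assoc]
    · constructor <;> intros <;>
        simp [hB.add_left, hB.add_right, hB.smul_left, hB.smul_right]
  · constructor <;> intros <;>
      simp [sweedler, hB.add_left, hB.add_right, hB.smul_left, hB.smul_right]

theorem sweedler_piR_piL (x : A) {B : A → A → M} (hB : IsBilin K B) :
    sweedler Δ x (fun a b => B (piR K A Δ ε a) (piL K A Δ ε b)) =
      sweedler Δ x fun a b => B (piR K A Δ ε b) (piL K A Δ ε a) := by
  have e (a b : A) : B (piR K A Δ ε a) (piL K A Δ ε b) =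
      sweedler Δ 1 fun p q => sweedler Δ 1 fun r s => (ε (a * q) * ε (r * b)) • B p s := by
    simp only [piR_eq, piL_eq, hB.sweedler_left, hB.sweedler_right, hB.smul_left, hB.smul_right,
      mul_smul]
  have e' (p q r s : A) : sweedler Δ x (fun a b => (ε (a * q) * ε (r * b)) • B p s) =
      sweedler Δ x fun a b => (ε (b * q) * ε (r * a)) • B p s := by
    have := (h.counit_mul_mul' r x q).symm.trans (h.counit_mul_mul r x q)
    have := congrArg (· • B p s) this
    simpa [sweedler, Finset.sum_smul, mul_comm] using this
  simp only [e, sweedler_comm x, e']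

end WeakBialgebra
namespace WeakHopfAlgebra

variable {S : A →ₗ[K] A} (h : WeakHopfAlgebra K A Δ ε S)
include h

theorem sweedler_piR_mul_antipode (x : A) :
    sweedler Δ x (fun a b => piR K A Δ ε a * S b) = S x := by
  rw [← h.sweedler_antipode_mul_piL x]
  simp only [← h.sweedler_antipode_mul, ← h.sweedler_mul_antipode, sweedler_mul, mul_sweedler]
  rw [h.toWeakBialgebra.sweedler_coassoc (T := fun a b c => S a * b * S c)]
  · simp only [mul_assoc]
  · constructor <;> intros <;> simp

theorem sweedler_antipode_mul_piR_mul (x y : A) :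
    sweedler Δ y (fun c d => S c * (piR K A Δ ε x * d)) = piR K A Δ ε (x * y) := by
  rw [← h.toWeakBialgebra.piR_piR_mul, ← h.sweedler_antipode_mul (_ * y),
    h.toWeakBialgebra.sweedler_piR_mul]
  constructor <;> intros <;> simp

theorem sweedler_mul_piL_mul_antipode (x y : A) :
    sweedler Δ x (fun a b => a * piL K A Δ ε y * S b) = piL K A Δ ε (x * y) := by
  rw [← h.toWeakBialgebra.piL_mul_piL, ← h.sweedler_mul_antipode (x * _),
    h.toWeakBialgebra.sweedler_mul_piL]
  constructor <;> intros <;> simp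

theorem antipode_mul (x y : A) : S (x * y) = S y * S x := by
  have hw := h.toWeakBialgebra
  calc S (x * y)
    _ = sweedler Δ x fun a b => sweedler Δ y fun c d => S (a * c) * piL K A Δ ε (b * d) := by
      rw [← h.sweedler_antipode_mul_piL, hw.sweedler_mul_arg]
      constructor <;> intros <;> simp
    _ = sweedler Δ x fun a b => sweedler Δ b fun p q => sweedler Δ y fun c d =>
          S (a * c) * (p * piL K A Δ ε d * S q) := by
      refine sweedler_congr fun a b => ?_
      rw [sweedler_comm]
      simp only [← h.sweedler_mul_piL_mul_antipode b, mul_sweedler]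
    _ = sweedler Δ x fun a b => sweedler Δ a fun p q => sweedler Δ y fun c d =>
          S (p * c) * (q * piL K A Δ ε d * S b) := by
      rw [hw.sweedler_coassoc (T := fun p q b => sweedler Δ y fun c d =>
          S (p * c) * (q * piL K A Δ ε d * S b))]
      constructor <;> intros <;> simp [sweedler]
    _ = sweedler Δ x fun a b => sweedler Δ a fun p q =>
          sweedler Δ y fun c d => sweedler Δ c fun r s =>
          S (p * r) * (q * (s * S d) * S b) := by
      refine sweedler_congr fun a b => sweedler_congr fun p q => ?_
      rw [hw.sweedler_coassoc (T := fun r s d => S (p * r) * (q * (s * S d) * S b))]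
      · simp only [← h.sweedler_mul_antipode, mul_sweedler, sweedler_mul]
      · constructor <;> intros <;> simp
    _ = sweedler Δ x fun a b => sweedler Δ y fun c d => piR K A Δ ε (a * c) * S d * S b := by
      refine sweedler_congr fun a b => ?_
      rw [sweedler_comm]
      refine sweedler_congr fun c d => ?_
      rw [← h.sweedler_antipode_mul, hw.sweedler_mul_arg]
      · simp only [sweedler_mul, mul_assoc]
      · constructor <;> intros <;> simp
    _ = sweedler Δ x fun a b => sweedler Δ y fun c d => sweedler Δ d fun r s =>
          S c * (piR K A Δ ε a * r) * S s * S b := by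
      refine sweedler_congr fun a b => ?_
      rw [← hw.sweedler_coassoc (T := fun c r s => S c * (piR K A Δ ε a * r) * S s * S b)]
      · simp only [← h.sweedler_antipode_mul_piR_mul a, sweedler_mul]
      · constructor <;> intros <;> simp
    _ = sweedler Δ x fun a b => sweedler Δ y fun c d =>
          S c * piL K A Δ ε d * (piR K A Δ ε a * S b) := by
      refine sweedler_congr fun a b => sweedler_congr fun c d => ?_
      rw [mul_assoc (S c), ← mul_assoc (piL K A Δ ε d), hw.piL_mul_piR_comm,
        ← h.sweedler_mul_antipode]
      simp only [mul_sweedler, sweedler_mul, mul_assoc]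
    _ = S y * S x := by
      rw [← h.sweedler_antipode_mul_piL y, ← h.sweedler_piR_mul_antipode x]
      simp only [mul_sweedler, sweedler_mul]

theorem antipode_one : S 1 = 1 := by
  have hw := h.toWeakBialgebra
  rw [← h.sweedler_antipode_mul_piL 1, hw.sweedler_piL_right 1 (B := fun a b => S a * b)]
  · simp only [mul_one, h.sweedler_antipode_mul, hw.piR_one]
  · constructor <;> intros <;> simp

theorem counit_antipode (x : A) : ε (S x) = ε x := by
  have hw := h.toWeakBialgebra
  rw [← h.sweedler_antipode_mul_piL x, map_sweedler]
  simp only [hw.counit_mul_piL]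
  rw [← map_sweedler, h.sweedler_antipode_mul, ← mul_one (piR K A Δ ε x), hw.counit_piR_mul,
    mul_one]

theorem antipode_piL (x : A) : S (piL K A Δ ε x) = piR K A Δ ε (piL K A Δ ε x) := by
  have hw := h.toWeakBialgebra
  rw [← h.sweedler_antipode_mul, hw.sweedler_piL]
  · simp only [h.antipode_mul, mul_assoc, ← mul_sweedler, h.sweedler_antipode_mul, hw.piR_one,
      mul_one]
  · constructor <;> intros <;> simp

theorem antipode_piR (x : A) : S (piR K A Δ ε x) = piL K A Δ ε (piR K A Δ ε x) := by
  have hw := h.toWeakBialgebra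
  rw [← h.sweedler_mul_antipode, hw.sweedler_piR]
  · simp only [h.antipode_mul, ← mul_assoc, ← sweedler_mul, h.sweedler_mul_antipode, hw.piL_one,
      one_mul]
  · constructor <;> intros <;> simp

theorem exists_antipode_piL (x : A) : ∃ y, S (piL K A Δ ε y) = piR K A Δ ε x := by
  have hw := h.toWeakBialgebra
  have e : sweedler Δ 1 (fun a b => ε (x * a) • b) =
      piL K A Δ ε (sweedler Δ 1 fun a b => ε (x * a) • b) := by
    rw [map_sweedler]
    simp only [map_smul]
    rw [hw.sweedler_piL_right 1 (B := fun a b => ε (x * a) • b)]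
    · simp only [mul_one]
    · constructor <;> intros <;> simp [smul_comm (M := K) (N := K)]
  refine ⟨sweedler Δ 1 fun a b => ε (x * a) • b, ?_⟩
  rw [h.antipode_piL, ← e, piR_eq, piR_eq]
  refine sweedler_congr fun a b => ?_
  conv_rhs => rw [← mul_one x, hw.counit_mul_mul]
  simp only [sweedler_mul, map_sweedler, smul_mul_assoc, map_smul, smul_eq_mul]

theorem exists_antipode_piR (x : A) : ∃ y, S (piR K A Δ ε y) = piL K A Δ ε x := by
  have hw := h.toWeakBialgebra
  have e : sweedler Δ 1 (fun a b => ε (b * x) • a) =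
      piR K A Δ ε (sweedler Δ 1 fun a b => ε (b * x) • a) := by
    rw [map_sweedler]
    simp only [map_smul]
    rw [hw.sweedler_piR_left 1 (B := fun a b => ε (b * x) • a)]
    · simp only [one_mul]
    · constructor <;> intros <;> simp [smul_comm (M := K) (N := K)]
  refine ⟨sweedler Δ 1 fun a b => ε (b * x) • a, ?_⟩
  rw [h.antipode_piR, ← e, piL_eq, piL_eq]
  refine sweedler_congr fun a b => ?_
  conv_rhs => rw [← mul_one a, hw.counit_mul_mul]
  simp only [mul_sweedler, map_sweedler, mul_smul_comm, map_smul, smul_eq_mul, mul_comm]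

theorem sweedler_piL_mul (x : A) : sweedler Δ x (fun a b => piL K A Δ ε a * b) = x := by
  have hw := h.toWeakBialgebra
  conv_rhs => rw [← hw.sweedler_counit_left x, ← one_mul x]
  rw [hw.sweedler_mul_arg]
  · simp only [piL_eq, sweedler_mul, smul_mul_assoc]
    rw [sweedler_comm]
  · constructor <;> intros <;> simp [smul_comm (M := K) (N := K)]

/-- A multiplicative map is determined by its composite with the antipode and its values on
`A^L` and `A^R`; the same holds for antimultiplicative maps. -/
theorem hom_ext {f g : A →ₗ[K] A} {R : A → A → A} (hR : IsBilin K R)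
    (assoc : ∀ a b c, R (R a b) c = R a (R b c))
    (hf : ∀ a b, f (a * b) = R (f a) (f b)) (hg : ∀ a b, g (a * b) = R (g a) (g b))
    (hS : ∀ x, f (S x) = g (S x)) (hL : ∀ x, f (piL K A Δ ε x) = g (piL K A Δ ε x))
    (hRR : ∀ x, f (piR K A Δ ε x) = g (piR K A Δ ε x)) : f = g := by
  have hw := h.toWeakBialgebra
  have e (x : A) : sweedler Δ x (fun a b => a * piR K A Δ ε b) = x := by
    conv_rhs => rw [← h.sweedler_piL_mul x]
    simp only [← h.sweedler_antipode_mul, ← h.sweedler_mul_antipode, sweedler_mul, mul_sweedler]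
    rw [hw.sweedler_coassoc (T := fun a b c => a * S b * c)]
    · simp only [mul_assoc]
    · constructor <;> intros <;> simp
  ext x
  conv_lhs => rw [← h.sweedler_piL_mul x]
  conv_rhs => rw [← e x]
  simp only [map_sweedler, hf, hg, hL, ← hRR]
  simp only [← h.sweedler_antipode_mul, ← h.sweedler_mul_antipode, map_sweedler, hf, hg, ← hS,
    hR.sweedler_left, hR.sweedler_right]
  rw [hw.sweedler_coassoc (T := fun a b c => R (R (g a) (f (S b))) (f c))]
  · simp only [assoc]
  · constructor <;> intros <;>
      simp [hR.add_left, hR.add_right, hR.smul_left, hR.smul_right]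

end WeakHopfAlgebra
namespace WeakHopfAlgebra

variable {S : A →ₗ[K] A} (h : WeakHopfAlgebra K A Δ ε S)
include h

theorem sweedler_comul_mul_antipode (x : A) :
    sweedler Δ x (fun a b => Δ a * sweedler Δ b fun r s => S s ⊗ₜ[K] S r) =
      Δ (piL K A Δ ε x) := by
  have hw := h.toWeakBialgebra
  calc _
    _ = sweedler Δ x fun a b => sweedler Δ a fun p q => sweedler Δ b fun r s =>
          (p * S s) ⊗ₜ[K] (q * S r) := by
      refine sweedler_congr fun a b => ?_
      rw [← sweedler_tmul a]
      simp only [sweedler_mul, mul_sweedler, Algebra.TensorProduct.tmul_mul_tmul]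
      rw [sweedler_comm]
    _ = sweedler Δ x fun p b => sweedler Δ b fun q c => sweedler Δ c fun r s =>
          (p * S s) ⊗ₜ[K] (q * S r) := by
      rw [hw.sweedler_coassoc (T := fun p q b => sweedler Δ b fun r s =>
        (p * S s) ⊗ₜ[K] (q * S r))]
      constructor <;> intros <;> simp [sweedler]
    _ = sweedler Δ x fun p b => sweedler Δ b fun c s => (p * S s) ⊗ₜ[K] piL K A Δ ε c := by
      refine sweedler_congr fun p b => ?_
      rw [← hw.sweedler_coassoc (T := fun q r s => (p * S s) ⊗ₜ[K] (q * S r))]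
      · simp only [← h.sweedler_mul_antipode]
        simp [sweedler, TensorProduct.tmul_sum]
      · constructor <;> intros <;> simp
    _ = sweedler Δ x fun a s => sweedler Δ 1 fun p q => (p * a * S s) ⊗ₜ[K] q := by
      rw [← hw.sweedler_coassoc (T := fun p c s => (p * S s) ⊗ₜ[K] piL K A Δ ε c)]
      · refine sweedler_congr fun a s => ?_
        rw [hw.sweedler_piL_right a (B := fun p c => (p * S s) ⊗ₜ[K] c)]
        constructor <;> intros <;> simp
      · constructor <;> intros <;> simp
    _ = Δ (piL K A Δ ε x) := by
      rw [← sweedler_tmul (piL K A Δ ε x), hw.sweedler_piL, sweedler_comm]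
      · simp only [← h.sweedler_mul_antipode x]
        simp [sweedler, TensorProduct.sum_tmul, mul_assoc, Finset.mul_sum]
      · constructor <;> intros <;> simp

theorem sweedler_antipode_mul_comul_aux (x : A) :
    sweedler Δ x (fun a b => (sweedler Δ a fun r s => S s ⊗ₜ[K] S r) * Δ b) =
      sweedler Δ x fun a b => sweedler Δ b fun c d => piR K A Δ ε c ⊗ₜ[K] (S a * d) := by
  have hw := h.toWeakBialgebra
  calc _
    _ = sweedler Δ x fun a b => sweedler Δ a fun r s => sweedler Δ b fun p q =>
          (S s * p) ⊗ₜ[K] (S r * q) := by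
      refine sweedler_congr fun a b => ?_
      rw [← sweedler_tmul b]
      simp only [sweedler_mul, mul_sweedler, Algebra.TensorProduct.tmul_mul_tmul]
      rw [sweedler_comm]
    _ = sweedler Δ x fun r b => sweedler Δ b fun s c => sweedler Δ c fun p q =>
          (S s * p) ⊗ₜ[K] (S r * q) := by
      rw [hw.sweedler_coassoc (T := fun r s b => sweedler Δ b fun p q =>
        (S s * p) ⊗ₜ[K] (S r * q))]
      constructor <;> intros <;> simp [sweedler]
    _ = _ := by
      refine sweedler_congr fun r b => ?_
      rw [← hw.sweedler_coassoc (T := fun s p q => (S s * p) ⊗ₜ[K] (S r * q))]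
      · simp only [← h.sweedler_antipode_mul]
        simp [sweedler, TensorProduct.sum_tmul]
      · constructor <;> intros <;> simp

theorem sweedler_antipode_mul_comul (x : A) :
    sweedler Δ x (fun a b => (sweedler Δ a fun r s => S s ⊗ₜ[K] S r) * Δ b) =
      Δ (piR K A Δ ε x) := by
  have hw := h.toWeakBialgebra
  calc _
    _ = sweedler Δ x fun a b => sweedler Δ 1 fun c d => c ⊗ₜ[K] (S a * (b * d)) := by
      rw [h.sweedler_antipode_mul_comul_aux]
      refine sweedler_congr fun a b => ?_
      rw [hw.sweedler_piR_left b (B := fun c d => c ⊗ₜ[K] (S a * d))]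
      constructor <;> intros <;> simp
    _ = Δ (piR K A Δ ε x) := by
      rw [← sweedler_tmul (piR K A Δ ε x), hw.sweedler_piR, sweedler_comm]
      · simp only [← h.sweedler_antipode_mul x]
        simp [sweedler, TensorProduct.tmul_sum, mul_assoc, Finset.sum_mul]
      · constructor <;> intros <;> simp

theorem sweedler_comul_piR_mul_antipode (x : A) :
    sweedler Δ x (fun a b => Δ (piR K A Δ ε a) * sweedler Δ b fun r s => S s ⊗ₜ[K] S r) =
      sweedler Δ x fun r s => S s ⊗ₜ[K] S r := by
  have hw := h.toWeakBialgebra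
  calc _
    _ = sweedler Δ x fun a b => sweedler Δ a fun r e => sweedler Δ e fun c q =>
          sweedler Δ b fun u v => (piR K A Δ ε c * S v) ⊗ₜ[K] (S r * (q * S u)) := by
      refine sweedler_congr fun a b => ?_
      rw [← h.sweedler_antipode_mul_comul, h.sweedler_antipode_mul_comul_aux]
      simp only [sweedler_mul, mul_sweedler, Algebra.TensorProduct.tmul_mul_tmul, mul_assoc]
      rw [sweedler_comm]
      refine sweedler_congr fun r e => ?_
      rw [sweedler_comm]
    _ = sweedler Δ x fun r y => sweedler Δ y fun e b => sweedler Δ e fun c q =>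
          sweedler Δ b fun u v => (piR K A Δ ε c * S v) ⊗ₜ[K] (S r * (q * S u)) := by
      rw [hw.sweedler_coassoc (T := fun r e b => sweedler Δ e fun c q =>
          sweedler Δ b fun u v => (piR K A Δ ε c * S v) ⊗ₜ[K] (S r * (q * S u)))]
      constructor <;> intros <;> simp [sweedler]
    _ = sweedler Δ x fun r y => sweedler Δ y fun c z => sweedler Δ z fun w v =>
          (piR K A Δ ε c * S v) ⊗ₜ[K] (S r * piL K A Δ ε w) := by
      refine sweedler_congr fun r y => ?_
      rw [hw.sweedler_coassoc (T := fun c q b => sweedler Δ b fun u v =>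
        (piR K A Δ ε c * S v) ⊗ₜ[K] (S r * (q * S u)))]
      · refine sweedler_congr fun c z => ?_
        rw [← hw.sweedler_coassoc (T := fun q u v =>
          (piR K A Δ ε c * S v) ⊗ₜ[K] (S r * (q * S u)))]
        · simp only [← h.sweedler_mul_antipode, mul_sweedler]
          simp [sweedler, TensorProduct.tmul_sum]
        · constructor <;> intros <;> simp
      · constructor <;> intros <;> simp [sweedler]
    _ = sweedler Δ x fun r y => sweedler Δ y fun m v => sweedler Δ m fun w c =>
          (piR K A Δ ε c * S v) ⊗ₜ[K] (S r * piL K A Δ ε w) := by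
      refine sweedler_congr fun r y => ?_
      rw [← hw.sweedler_coassoc (T := fun c w v =>
        (piR K A Δ ε c * S v) ⊗ₜ[K] (S r * piL K A Δ ε w))]
      · refine sweedler_congr fun m v => ?_
        rw [hw.sweedler_piR_piL m (B := fun c w => (c * S v) ⊗ₜ[K] (S r * w))]
        constructor <;> intros <;> simp
      · constructor <;> intros <;> simp
    _ = sweedler Δ x fun r y => sweedler Δ y fun w n => S n ⊗ₜ[K] (S r * piL K A Δ ε w) := by
      refine sweedler_congr fun r y => ?_
      rw [hw.sweedler_coassoc (T := fun w c v =>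
        (piR K A Δ ε c * S v) ⊗ₜ[K] (S r * piL K A Δ ε w))]
      · refine sweedler_congr fun w n => ?_
        rw [← h.sweedler_piR_mul_antipode n]
        simp [sweedler, TensorProduct.sum_tmul]
      · constructor <;> intros <;> simp
    _ = _ := by
      rw [← hw.sweedler_coassoc (T := fun r w n => S n ⊗ₜ[K] (S r * piL K A Δ ε w))]
      · refine sweedler_congr fun a n => ?_
        rw [← h.sweedler_antipode_mul_piL a]
        simp [sweedler, TensorProduct.tmul_sum]
      · constructor <;> intros <;> simp

theorem comul_antipode (x : A) : Δ (S x) = sweedler Δ x fun a b => S b ⊗ₜ[K] S a := by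
  have hw := h.toWeakBialgebra
  rw [← h.sweedler_comul_piR_mul_antipode, ← h.sweedler_antipode_mul_piL x, map_sweedler]
  simp only [hw.comul_mul, ← h.sweedler_comul_mul_antipode, mul_sweedler _ (Δ (S _))]
  rw [← hw.sweedler_coassoc
    (T := fun a b c => Δ (S a) * (Δ b * sweedler Δ c fun r s => S s ⊗ₜ[K] S r))]
  · refine sweedler_congr fun a b => ?_
    simp only [← mul_assoc, ← sweedler_mul]
    simp only [← hw.comul_mul, ← map_sweedler, h.sweedler_antipode_mul]
  · constructor <;> intros <;>
      simp [sweedler, -TensorProduct.smul_tmul', -Finset.smul_sum, ← Finset.smul_sum]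

theorem antipode_pow_mul (n : ℕ) :
    (∀ x y, (S ^ n) (x * y) = (S ^ n) x * (S ^ n) y) ∨
      ∀ x y, (S ^ n) (x * y) = (S ^ n) y * (S ^ n) x := by
  induction n with
  | zero => simp
  | succ n ih =>
    rcases ih with ih | ih
    · exact .inr fun x y => by simp only [pow_succ', Module.End.mul_apply, ih, h.antipode_mul]
    · exact .inl fun x y => by simp only [pow_succ', Module.End.mul_apply, ih, h.antipode_mul]

theorem antipode_pow_two_mul (n : ℕ) (x y : A) :
    (S ^ (2 * n)) (x * y) = (S ^ (2 * n)) x * (S ^ (2 * n)) y := by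
  induction n with
  | zero => simp
  | succ n ih => simp only [mul_add, mul_one, pow_succ', Module.End.mul_apply, ih, h.antipode_mul]

theorem pi_mem_range_antipode_pow (n : ℕ) (x : A) :
    piL K A Δ ε x ∈ LinearMap.range (S ^ n) ∧ piR K A Δ ε x ∈ LinearMap.range (S ^ n) := by
  induction n generalizing x with
  | zero => simp
  | succ n ih =>
    obtain ⟨y, hy⟩ := h.exists_antipode_piR x
    obtain ⟨z, hz⟩ := h.exists_antipode_piL x
    obtain ⟨y', hy'⟩ := (ih y).2
    obtain ⟨z', hz'⟩ := (ih z).1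
    exact ⟨⟨y', by simp [pow_succ', hy', hy]⟩, ⟨z', by simp [pow_succ', hz', hz]⟩⟩

theorem antipode_bijective : Function.Bijective S := by
  obtain ⟨n, hn⟩ := Filter.eventually_atTop.1 S.eventually_isCompl_ker_pow_range_pow
  set N := 2 * (n + 1) with hN
  have hc := hn N (by omega)
  obtain ⟨φ, hφr, hφ⟩ : ∃ φ : A →ₗ[K] A, (∀ x, φ x ∈ LinearMap.range (S ^ N)) ∧
      ∀ x, (S ^ N) (φ x) = (S ^ N) x := by
    refine ⟨_, Submodule.projection_apply_mem hc.symm, fun x => ?_⟩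
    have := Submodule.sub_projection_mem hc.symm x
    rwa [LinearMap.mem_ker, map_sub, sub_eq_zero, eq_comm] at this
  have huniq {x y : A} (hy : y ∈ LinearMap.range (S ^ N)) (hxy : (S ^ N) y = (S ^ N) x) :
      φ x = y := by
    have h₁ : φ x - y ∈ LinearMap.ker (S ^ N) := by simp [hφ, hxy]
    exact sub_eq_zero.1 (Submodule.disjoint_def.1 hc.disjoint _ h₁ (sub_mem (hφr x) hy))
  have hφ_mul (x y : A) : φ (x * y) = φ x * φ y := by
    refine huniq ?_ (by simp only [hN, h.antipode_pow_two_mul]; simp only [← hN, hφ])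
    obtain ⟨u, hu⟩ := hφr x
    obtain ⟨v, hv⟩ := hφr y
    exact ⟨u * v, by rw [← hu, ← hv, hN, h.antipode_pow_two_mul]⟩
  have hcomm (x : A) : (S ^ N) (S x) = S ((S ^ N) x) := by
    rw [← Module.End.mul_apply, ← pow_succ, pow_succ', Module.End.mul_apply]
  have hφS (x : A) : φ (S x) = S (φ x) := by
    refine huniq ?_ (by rw [hcomm, hφ, hcomm])
    obtain ⟨u, hu⟩ := hφr x
    exact ⟨S u, by rw [hcomm, hu]⟩
  have key (k : ℕ) (hk : (S ^ (k + 1)) ∘ₗ φ = S ^ (k + 1)) : (S ^ k) ∘ₗ φ = S ^ k := by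
    have hS (x : A) : ((S ^ k) ∘ₗ φ) (S x) = (S ^ k) (S x) := by
      simpa [hφS, pow_succ] using LinearMap.congr_fun hk x
    have hL (x : A) : φ (piL K A Δ ε x) = piL K A Δ ε x :=
      huniq (h.pi_mem_range_antipode_pow N x).1 rfl
    have hR (x : A) : φ (piR K A Δ ε x) = piR K A Δ ε x :=
      huniq (h.pi_mem_range_antipode_pow N x).2 rfl
    rcases h.antipode_pow_mul k with hm | hm
    · refine h.hom_ext (R := fun a b => a * b) ?_ mul_assoc (by simp [hφ_mul, hm]) hm hS
        (by simp [hL]) (by simp [hR])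
      constructor <;> intros <;> simp
    · refine h.hom_ext (R := fun a b => b * a) ?_ (fun a b c => (mul_assoc c b a).symm)
        (by simp [hφ_mul, hm]) hm hS (by simp [hL]) (by simp [hR])
      constructor <;> intros <;> simp
  have hid : (S ^ 0) ∘ₗ φ = S ^ 0 :=
    Nat.decreasingInduction (motive := fun k _ => (S ^ k) ∘ₗ φ = S ^ k) (fun k _ => key k)
      (LinearMap.ext hφ) N.zero_le
  have hsurj : Function.Surjective S := fun x => by
    obtain ⟨u, hu⟩ := hφr x
    refine ⟨(S ^ (2 * n + 1)) u, ?_⟩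
    rw [← Module.End.mul_apply, ← pow_succ']
    exact hu.trans (LinearMap.congr_fun hid x)
  exact ⟨LinearMap.injective_iff_surjective.2 hsurj, hsurj⟩

end WeakHopfAlgebra

end Sweedler

/-- In a weak Hopf algebra `A` over a field `K`, the antipode `S` is
antimultiplicative and anticomultiplicative, satisfies `S(1) = 1` and `ε ∘ S = ε`,
maps `A^L` bijectively onto `A^R` and `A^R` bijectively onto `A^L`, and is a bijection
of `A` onto itself. -/
theorem weakHopfAlgebra_antipode_properties
    (K : Type*) [Field K] (A : Type*) [Ring A] [Algebra K A] [FiniteDimensional K A]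
    (Δ : A →ₗ[K] A ⊗[K] A) (ε : A →ₗ[K] K) (S : A →ₗ[K] A)
    (hA : WeakHopfAlgebra K A Δ ε S) :
    (∀ x y : A, S (x * y) = S y * S x) ∧
    (∀ x : A, Δ (S x) = (TensorProduct.comm K A A) (TensorProduct.map S S (Δ x))) ∧
    S 1 = 1 ∧
    (∀ x : A, ε (S x) = ε x) ∧
    Set.BijOn ⇑S (Set.range ⇑(piL K A Δ ε)) (Set.range ⇑(piR K A Δ ε)) ∧
    Set.BijOn ⇑S (Set.range ⇑(piR K A Δ ε)) (Set.range ⇑(piL K A Δ ε)) ∧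
    Function.Bijective ⇑S := by
  have hinj := hA.antipode_bijective.injective
  refine ⟨hA.antipode_mul, fun x => ?_, hA.antipode_one, hA.counit_antipode,
    ⟨?_, hinj.injOn, ?_⟩, ⟨?_, hinj.injOn, ?_⟩, hA.antipode_bijective⟩
  · rw [hA.comul_antipode, ← sweedler_tmul x]
    simp [sweedler]
  · rintro _ ⟨x, rfl⟩
    exact ⟨_, (hA.antipode_piL x).symm⟩
  · rintro _ ⟨x, rfl⟩
    obtain ⟨y, hy⟩ := hA.exists_antipode_piL x
    exact ⟨_, ⟨y, rfl⟩, hy⟩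
  · rintro _ ⟨x, rfl⟩
    exact ⟨_, (hA.antipode_piR x).symm⟩
  · rintro _ ⟨x, rfl⟩
    obtain ⟨y, hy⟩ := hA.exists_antipode_piR x
    exact ⟨_, ⟨y, rfl⟩, hy⟩
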